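/- Every finitely generated non-elementary subgroup of a word hyperbolic group has infinite girth. -/

import Mathlib

/-- A finitely generated group has infinite girth. -/
def HasInfiniteGirth (G : Type*) [Group G] : Prop :=
  ∀ n : ℕ, ∃ (k : ℕ) (s : Fin k → G), Subgroup.closure (Set.range s) = ⊤ ∧
    ∀ w : FreeGroup (Fin k), w ≠ 1 → w.norm ≤ n → FreeGroup.lift s w ≠ 1

/-- Word length of `g` with respect to a generating set `S`. -/
noncomputable def wordLength {G : Type*} [Group G] (S : Set G) (g : G) : ℕ :=
  sInf {n | ∃ L : List G, L.length = n ∧ (∀ x ∈ L, x ∈ S ∪ S⁻¹) ∧ L.prod = g}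

/-- Word metric with respect to `S`. -/
noncomputable def wordDist {G : Type*} [Group G] (S : Set G) (g h : G) : ℝ :=
  (wordLength S (g⁻¹ * h) : ℝ)

/-- Gromov product `(x,y)_w` with respect to the word metric. -/
noncomputable def gromovProd {G : Type*} [Group G] (S : Set G) (x y w : G) : ℝ :=
  (wordDist S w x + wordDist S w y - wordDist S x y) / 2

/-- `G` is word hyperbolic: finitely generated, and for some finite generating set the
word metric satisfies the Gromov four-point condition for some `δ ≥ 0`. -/
def IsWordHyperbolic (G : Type*) [Group G] : Prop :=
  ∃ S : Set G, S.Finite ∧ Subgroup.closure S = ⊤ ∧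
    ∃ δ : ℝ, 0 ≤ δ ∧ ∀ x y z w : G,
      min (gromovProd S x y w) (gromovProd S y z w) - δ ≤ gromovProd S x z w

/-- A subgroup is elementary if it is virtually cyclic, i.e. contains a cyclic
subgroup of finite index. -/
def IsVirtuallyCyclic (G : Type*) [Group G] : Prop :=
  ∃ g : G, (Subgroup.zpowers g).index ≠ 0

/-- A length function on a group whose associated left-invariant metric `ℓ (x⁻¹ * y)` is proper
and satisfies the four-point condition with constant `δ`. -/
structure IsHypLength {G : Type*} [Group G] (ℓ : G → ℝ) (δ : ℝ) : Prop where
  pos : 0 < δ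
  one : ℓ 1 = 0
  inv : ∀ g, ℓ g⁻¹ = ℓ g
  mul_le : ∀ g h, ℓ (g * h) ≤ ℓ g + ℓ h
  finite_ball : ∀ r, {g | ℓ g ≤ r}.Finite
  four_point : ∀ x y z w, ℓ (x⁻¹ * z) + ℓ (y⁻¹ * w) ≤ ℓ (x⁻¹ * y) + ℓ (z⁻¹ * w) + 2 * δ ∨
    ℓ (x⁻¹ * z) + ℓ (y⁻¹ * w) ≤ ℓ (x⁻¹ * w) + ℓ (y⁻¹ * z) + 2 * δ

/-- The powers of `a` form a quasi-geodesic in the metric defined by `ℓ`. -/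
structure IsLoxodromic {G : Type*} [Group G] (ℓ : G → ℝ) (a : G) : Prop where
  quasi_additive : ∃ C, ∀ i j : ℕ, ℓ (a ^ i) + ℓ (a ^ j) ≤ ℓ (a ^ (i + j)) + C
  unbounded : ∀ R, ∃ N : ℕ, ∀ n, N ≤ n → R < ℓ (a ^ n)

/-- The Gromov product with respect to the left-invariant metric defined by `ℓ`. -/
noncomputable def gp {G : Type*} [Group G] (ℓ : G → ℝ) (x y w : G) : ℝ :=
  (ℓ (w⁻¹ * x) + ℓ (w⁻¹ * y) - ℓ (x⁻¹ * y)) / 2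

namespace IsHypLength

variable {G : Type*} [Group G] {ℓ : G → ℝ} {δ : ℝ}

theorem nonneg (h : IsHypLength ℓ δ) (g : G) : 0 ≤ ℓ g := by
  have := h.mul_le g g⁻¹
  rw [mul_inv_cancel, h.one, h.inv] at this
  linarith

theorem dist_comm (h : IsHypLength ℓ δ) (x y : G) : ℓ (x⁻¹ * y) = ℓ (y⁻¹ * x) := by
  rw [← h.inv]; simp

theorem dist_triangle (h : IsHypLength ℓ δ) (x y z : G) :
    ℓ (x⁻¹ * z) ≤ ℓ (x⁻¹ * y) + ℓ (y⁻¹ * z) := by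
  have := h.mul_le (x⁻¹ * y) (y⁻¹ * z)
  rwa [show x⁻¹ * y * (y⁻¹ * z) = x⁻¹ * z by group] at this

theorem gp_comm (h : IsHypLength ℓ δ) (x y w : G) : gp ℓ x y w = gp ℓ y x w := by
  unfold gp; rw [h.dist_comm x y]; ring

theorem gp_mul_left (g x y w : G) : gp ℓ (g * x) (g * y) (g * w) = gp ℓ x y w := by
  unfold gp
  simp [mul_assoc]

theorem gp_base_le (h : IsHypLength ℓ δ) (x y w w' : G) :
    gp ℓ x y w ≤ gp ℓ x y w' + ℓ (w⁻¹ * w') := by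
  unfold gp
  linarith [h.dist_triangle w w' x, h.dist_triangle w w' y]

theorem gp_left_le (h : IsHypLength ℓ δ) (x x' y w : G) :
    gp ℓ x y w ≤ gp ℓ x' y w + ℓ (x⁻¹ * x') := by
  unfold gp
  linarith [h.dist_triangle w x' x, h.dist_comm x x', h.dist_triangle x' x y]

theorem gp_le_left (h : IsHypLength ℓ δ) (x y w : G) : gp ℓ x y w ≤ ℓ (w⁻¹ * x) := by
  unfold gp
  linarith [h.dist_triangle w x y]

theorem gp_nonneg (h : IsHypLength ℓ δ) (x y w : G) : 0 ≤ gp ℓ x y w := by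
  unfold gp
  linarith [h.dist_triangle x w y, h.dist_comm x w]

theorem gp_four_point (h : IsHypLength ℓ δ) (x y z w : G) :
    gp ℓ x y w ≤ gp ℓ x z w + δ ∨ gp ℓ y z w ≤ gp ℓ x z w + δ := by
  unfold gp
  rcases h.four_point x y z w with H | H
  · left; linarith [h.dist_comm w x, h.dist_comm w y, h.dist_comm w z]
  · right; linarith [h.dist_comm w x, h.dist_comm w y, h.dist_comm w z]

theorem pow_length_le (h : IsHypLength ℓ δ) (a : G) (n : ℕ) : ℓ (a ^ n) ≤ n * ℓ a := by
  induction n with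
  | zero => simp [h.one]
  | succ n ih =>
    rw [pow_succ]
    push_cast
    linarith [h.mul_le (a ^ n) a]

theorem inv_pow_mul_pow (a : G) {i j : ℕ} (hij : i ≤ j) : (a ^ i)⁻¹ * a ^ j = a ^ (j - i) := by
  rw [pow_sub a hij, ((Commute.refl a).pow_pow i j).inv_left.eq]

theorem pow_growth (h : IsHypLength ℓ δ) {a : G} (ha : ℓ a + 4 * δ < ℓ (a ^ 2)) (n : ℕ) :
    ℓ (a ^ n) + 2 * δ ≤ ℓ (a ^ (n + 1)) := by
  have hδ := h.pos
  have h2 := h.pow_length_le a 2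
  induction n with
  | zero => simp [h.one]; push_cast at h2; linarith
  | succ n ih =>
    have key := h.four_point 1 a (a ^ 2) (a ^ (n + 2))
    have e1 := inv_pow_mul_pow a (show 1 ≤ n + 2 by omega)
    have e2 := inv_pow_mul_pow a (show 2 ≤ n + 2 by omega)
    have e3 := inv_pow_mul_pow a (show 1 ≤ 2 by omega)
    rw [show n + 2 - 1 = n + 1 by omega, pow_one] at e1
    rw [show n + 2 - 2 = n by omega] at e2
    rw [show 2 - 1 = 1 by omega, pow_one] at e3
    rw [e1, e2, e3] at key
    simp only [inv_one, one_mul] at key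
    rcases key with key | key
    · linarith
    · rw [show n + 1 + 1 = n + 2 by omega]; linarith

theorem pow_growth_le (h : IsHypLength ℓ δ) {a : G} (ha : ℓ a + 4 * δ < ℓ (a ^ 2)) (n : ℕ) :
    n * (2 * δ) ≤ ℓ (a ^ n) := by
  induction n with
  | zero => simp [h.one]
  | succ n ih => push_cast; linarith [h.pow_growth ha n]

theorem pow_quasi_additive (h : IsHypLength ℓ δ) {a : G} (ha : ℓ a + 4 * δ < ℓ (a ^ 2))
    (i j : ℕ) : ℓ (a ^ i) + ℓ (a ^ j) ≤ ℓ (a ^ (i + j)) + (ℓ a + 2 * δ) := by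
  have hδ := h.pos
  rcases j with _ | j
  · simp [h.one]; linarith [h.nonneg a]
  have key := h.four_point 1 (a ^ i) (a ^ (i + 1)) (a ^ (i + (j + 1)))
  have e1 := inv_pow_mul_pow a (show i ≤ i + (j + 1) by omega)
  have e2 := inv_pow_mul_pow a (show i + 1 ≤ i + (j + 1) by omega)
  have e3 := inv_pow_mul_pow a (show i ≤ i + 1 by omega)
  rw [show i + (j + 1) - i = j + 1 by omega] at e1
  rw [show i + (j + 1) - (i + 1) = j by omega] at e2
  rw [show i + 1 - i = 1 by omega, pow_one] at e3
  rw [e1, e2, e3] at key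
  simp only [inv_one, one_mul] at key
  have g1 := h.pow_growth ha i
  have g2 := h.pow_growth ha j
  rcases key with key | key <;> linarith

/-- An element that moves some point `p` much less than its square does is loxodromic. -/
theorem isLoxodromic_of_lt (h : IsHypLength ℓ δ) (g p : G)
    (hg : ℓ (p⁻¹ * (g * p)) + 4 * δ < ℓ (p⁻¹ * (g ^ 2 * p))) : IsLoxodromic ℓ g := by
  set a := p⁻¹ * g * p with ha_def
  have hpow : ∀ n : ℕ, a ^ n = p⁻¹ * g ^ n * p := fun n => by
    have := conj_pow (a := p⁻¹) (b := g) (i := n)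
    rwa [inv_inv] at this
  have ha : ℓ a + 4 * δ < ℓ (a ^ 2) := by
    rw [hpow, ha_def, mul_assoc, mul_assoc]; exact hg
  have lo : ∀ n : ℕ, ℓ (a ^ n) ≤ ℓ (g ^ n) + 2 * ℓ p := fun n => by
    rw [hpow]
    linarith [h.mul_le (p⁻¹ * g ^ n) p, h.mul_le p⁻¹ (g ^ n), h.inv p]
  have hi : ∀ n : ℕ, ℓ (g ^ n) ≤ ℓ (a ^ n) + 2 * ℓ p := fun n => by
    have : g ^ n = p * a ^ n * p⁻¹ := by rw [hpow]; group
    rw [this]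
    linarith [h.mul_le (p * a ^ n) p⁻¹, h.mul_le p (a ^ n), h.inv p]
  refine ⟨⟨ℓ a + 2 * δ + 6 * ℓ p, fun i j => ?_⟩, fun R => ?_⟩
  · linarith [h.pow_quasi_additive ha i j, hi i, hi j, lo (i + j)]
  · have hδ := h.pos
    obtain ⟨N, hN⟩ := exists_nat_gt ((R + 2 * ℓ p) / (2 * δ))
    refine ⟨N, fun n hn => ?_⟩
    rw [div_lt_iff₀ (by linarith)] at hN
    have : (N : ℝ) * (2 * δ) ≤ n * (2 * δ) := by gcongr
    linarith [h.pow_growth_le ha n, lo n]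

/-- Restriction of a hyperbolic length function to a subgroup. -/
theorem restrict (h : IsHypLength ℓ δ) (Γ : Subgroup G) :
    IsHypLength (fun g : Γ => ℓ (g : G)) δ where
  pos := h.pos
  one := h.one
  inv g := h.inv g
  mul_le g g' := h.mul_le g g'
  finite_ball r := (h.finite_ball r).preimage Subtype.val_injective.injOn
  four_point x y z w := h.four_point x y z w

end IsHypLength

section WordLength

variable {G : Type*} [Group G] {S : Set G}

theorem exists_list_of_closure_eq_top (hS : Subgroup.closure S = ⊤) (g : G) :
    ∃ L : List G, L.length = wordLength S g ∧ (∀ x ∈ L, x ∈ S ∪ S⁻¹) ∧ L.prod = g := by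
  have hne : {n | ∃ L : List G, L.length = n ∧ (∀ x ∈ L, x ∈ S ∪ S⁻¹) ∧ L.prod = g}.Nonempty := by
    have hg : g ∈ (Subgroup.closure S).toSubmonoid := by rw [hS]; trivial
    rw [Subgroup.closure_toSubmonoid] at hg
    obtain ⟨L, hL, hprod⟩ := Submonoid.exists_list_of_mem_closure hg
    exact ⟨L.length, L, rfl, hL, hprod⟩
  exact Nat.sInf_mem hne

theorem wordLength_list_prod_le {L : List G} (hL : ∀ x ∈ L, x ∈ S ∪ S⁻¹) :
    wordLength S L.prod ≤ L.length :=
  Nat.sInf_le ⟨L, rfl, hL, rfl⟩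

theorem wordLength_one : wordLength S (1 : G) = 0 := by
  simpa using wordLength_list_prod_le (S := S) (L := []) (by simp)

theorem wordLength_mul_le (hS : Subgroup.closure S = ⊤) (g h : G) :
    wordLength S (g * h) ≤ wordLength S g + wordLength S h := by
  obtain ⟨L, hL, hLS, rfl⟩ := exists_list_of_closure_eq_top hS g
  obtain ⟨M, hM, hMS, rfl⟩ := exists_list_of_closure_eq_top hS h
  rw [← hL, ← hM, ← List.length_append, ← List.prod_append]
  refine wordLength_list_prod_le fun x hx => ?_
  rcases List.mem_append.1 hx with hx | hx
  exacts [hLS x hx, hMS x hx]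

theorem wordLength_inv_le (hS : Subgroup.closure S = ⊤) (g : G) :
    wordLength S g⁻¹ ≤ wordLength S g := by
  obtain ⟨L, hL, hLS, rfl⟩ := exists_list_of_closure_eq_top hS g
  rw [← hL, List.prod_inv_reverse]
  refine (wordLength_list_prod_le fun x hx => ?_).trans_eq (by simp)
  simp only [List.mem_reverse, List.mem_map] at hx
  obtain ⟨y, hy, rfl⟩ := hx
  rcases hLS y hy with h | h
  · right; simpa using h
  · left; simpa using h

theorem wordLength_inv (hS : Subgroup.closure S = ⊤) (g : G) :
    wordLength S g⁻¹ = wordLength S g :=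
  le_antisymm (wordLength_inv_le hS g) (by simpa using wordLength_inv_le hS g⁻¹)

theorem finite_wordLength_le (hfin : S.Finite) (hS : Subgroup.closure S = ⊤) (n : ℕ) :
    {g : G | wordLength S g ≤ n}.Finite := by
  have hT : (S ∪ S⁻¹).Finite := hfin.union hfin.inv
  have : Finite ↥(S ∪ S⁻¹) := hT
  refine ((List.finite_length_le ↥(S ∪ S⁻¹) n).image
    fun L => (L.map Subtype.val).prod).subset fun g hg => ?_
  obtain ⟨L, hL, hLS, rfl⟩ := exists_list_of_closure_eq_top hS g
  refine ⟨L.attach.map fun x => ⟨x.1, hLS x.1 x.2⟩, ?_, ?_⟩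
  · simpa [hL] using hg
  · simp [List.map_map, Function.comp_def]

/-- Points at every integer distance along a geodesic from the identity. -/
theorem exists_wordLength_eq (hS : Subgroup.closure S = ⊤) (g : G) {t : ℕ}
    (ht : t ≤ wordLength S g) :
    ∃ q, wordLength S q = t ∧ wordLength S (q⁻¹ * g) + t = wordLength S g := by
  obtain ⟨L, hL, hLS, hprod⟩ := exists_list_of_closure_eq_top hS g
  have h1 : wordLength S (L.take t).prod ≤ (L.take t).length :=
    wordLength_list_prod_le fun x hx => hLS x (List.mem_of_mem_take hx)
  have h2 : wordLength S (L.drop t).prod ≤ (L.drop t).length :=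
    wordLength_list_prod_le fun x hx => hLS x (List.mem_of_mem_drop hx)
  have hmul : (L.take t).prod * (L.drop t).prod = g := by
    rw [← List.prod_append, List.take_append_drop, hprod]
  have h3 := wordLength_mul_le hS (L.take t).prod (L.drop t).prod
  rw [hmul] at h3
  rw [List.length_take] at h1
  rw [List.length_drop] at h2
  refine ⟨(L.take t).prod, ?_, ?_⟩
  · omega
  · rw [← hmul, inv_mul_cancel_left, hmul]; omega

theorem isHypLength_wordLength (hfin : S.Finite) (hS : Subgroup.closure S = ⊤) {δ : ℝ}
    (hδ : 0 ≤ δ) (hyp : ∀ x y z w : G,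
      min (gromovProd S x y w) (gromovProd S y z w) - δ ≤ gromovProd S x z w) :
    IsHypLength (fun g => (wordLength S g : ℝ)) (δ + 1) where
  pos := by linarith
  one := by simp [wordLength_one]
  inv g := by rw [wordLength_inv hS]
  mul_le g h := by exact_mod_cast wordLength_mul_le hS g h
  finite_ball r := by
    refine (finite_wordLength_le hfin hS ⌊r⌋₊).subset fun g hg => ?_
    exact Nat.le_floor hg
  four_point x y z w := by
    have comm : ∀ u v : G, wordLength S (u⁻¹ * v) = wordLength S (v⁻¹ * u) := fun u v => by
      rw [← wordLength_inv hS]; simp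
    have key := hyp x y z w
    simp only [gromovProd, wordDist] at key
    rw [comm x w, comm y w, comm z w]
    rcases min_choice
      (((wordLength S (w⁻¹ * x) : ℝ) + wordLength S (w⁻¹ * y) - wordLength S (x⁻¹ * y)) / 2)
      (((wordLength S (w⁻¹ * y) : ℝ) + wordLength S (w⁻¹ * z) - wordLength S (y⁻¹ * z)) / 2)
      with h | h <;> rw [h] at key
    · left; linarith
    · right; linarith

end WordLength

namespace IsHypLength

section Existence

variable {G : Type*} [Group G] {ℓ : G → ℝ} {δ : ℝ}

theorem length_sq_le_of_not_isLoxodromic (h : IsHypLength ℓ δ) {g : G} (hg : ¬ IsLoxodromic ℓ g)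
    (p : G) : ℓ (p⁻¹ * (g ^ 2 * p)) ≤ ℓ (p⁻¹ * (g * p)) + 4 * δ :=
  not_lt.1 fun H => hg (h.isLoxodromic_of_lt g p H)

theorem length_inv_smul (h : IsHypLength ℓ δ) (g p : G) :
    ℓ (p⁻¹ * (g⁻¹ * p)) = ℓ (p⁻¹ * (g * p)) := by
  rw [← h.inv]; congr 1; group

theorem le_gp_inv (h : IsHypLength ℓ δ) {g : G} (hg : ¬ IsLoxodromic ℓ g) (p : G) :
    ℓ (p⁻¹ * (g * p)) / 2 - 2 * δ ≤ gp ℓ (g⁻¹ * p) (g * p) p := by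
  have h1 := h.length_sq_le_of_not_isLoxodromic hg p
  have e : (g⁻¹ * p)⁻¹ * (g * p) = p⁻¹ * (g ^ 2 * p) := by rw [pow_two]; group
  rw [gp, e, h.length_inv_smul]
  linarith

/-- If `s`, `t` and `s⁻¹ * t` are not loxodromic then `s` and `t` move `p` in nearly the same
direction. -/
theorem le_gp_of_not_isLoxodromic (h : IsHypLength ℓ δ) {s t : G} (hs : ¬ IsLoxodromic ℓ s)
    (ht : ¬ IsLoxodromic ℓ t) (hst : ¬ IsLoxodromic ℓ (s⁻¹ * t)) (p : G) :
    ℓ (p⁻¹ * (s * p)) / 2 - 6 * δ ≤ gp ℓ (s * p) (t * p) p ∨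
      ℓ (p⁻¹ * (t * p)) / 2 - 6 * δ ≤ gp ℓ (s * p) (t * p) p := by
  by_contra! H
  obtain ⟨H1, H2⟩ := H
  have hδ := h.pos
  set c := gp ℓ (s * p) (t * p) p with hc
  have ps := h.le_gp_inv hs p
  have pt := h.le_gp_inv ht p
  rw [h.gp_comm] at ps
  have pst := h.length_sq_le_of_not_isLoxodromic hst p
  have d1 : ℓ (p⁻¹ * (s⁻¹ * t * p)) = ℓ (p⁻¹ * (s * p)) + ℓ (p⁻¹ * (t * p)) - 2 * c := by
    rw [hc, gp, show p⁻¹ * (s⁻¹ * t * p) = (s * p)⁻¹ * (t * p) by group]; ring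
  have d2 : ℓ (p⁻¹ * (t⁻¹ * s * p)) = ℓ (p⁻¹ * (s * p)) + ℓ (p⁻¹ * (t * p)) - 2 * c := by
    rw [← d1, ← h.length_inv_smul (s⁻¹ * t)]; congr 1; group
  have q1 : gp ℓ (s⁻¹ * p) (s⁻¹ * t * p) p = ℓ (p⁻¹ * (s * p)) - c := by
    rw [gp, h.length_inv_smul, d1, show (s⁻¹ * p)⁻¹ * (s⁻¹ * t * p) = p⁻¹ * (t * p) by group]
    ring
  have q2 : gp ℓ (t⁻¹ * s * p) (t⁻¹ * p) p = ℓ (p⁻¹ * (t * p)) - c := by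
    rw [h.gp_comm, gp, h.length_inv_smul, d2,
      show (t⁻¹ * p)⁻¹ * (t⁻¹ * s * p) = p⁻¹ * (s * p) by group]
    ring
  have q3 : gp ℓ (s⁻¹ * t * p) (t⁻¹ * s * p) p =
      ℓ (p⁻¹ * (s * p)) + ℓ (p⁻¹ * (t * p)) - 2 * c - ℓ (p⁻¹ * ((s⁻¹ * t) ^ 2 * p)) / 2 := by
    rw [gp, d1, d2, h.dist_comm (s⁻¹ * t * p),
      show (t⁻¹ * s * p)⁻¹ * (s⁻¹ * t * p) = p⁻¹ * ((s⁻¹ * t) ^ 2 * p) by rw [pow_two]; group]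
    ring
  rcases h.gp_four_point (s * p) (s⁻¹ * p) (t * p) p with K | K
  · linarith
  rcases h.gp_four_point (s⁻¹ * p) (s⁻¹ * t * p) (t * p) p with K | K
  · linarith
  rcases h.gp_four_point (s⁻¹ * t * p) (t⁻¹ * s * p) (t * p) p with K | K
  · linarith
  rcases h.gp_four_point (t⁻¹ * s * p) (t⁻¹ * p) (t * p) p with K | K <;> linarith

/-- Moving the base point towards its image under the element of largest displacement decreases
the displacement of every element. -/
theorem displacement_lt (h : IsHypLength ℓ δ) {s t : G} (hs : ¬ IsLoxodromic ℓ s)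
    (ht : ¬ IsLoxodromic ℓ t) (hst : ¬ IsLoxodromic ℓ (s⁻¹ * t)) {p q : G} {r : ℝ}
    (hle : ℓ (p⁻¹ * (s * p)) ≤ ℓ (p⁻¹ * (t * p))) (hq : ℓ (p⁻¹ * q) = r)
    (hq' : ℓ (q⁻¹ * (t * p)) = ℓ (p⁻¹ * (t * p)) - r) (hr : 5 * δ ≤ r)
    (hbig : 4 * r + 12 * δ < ℓ (p⁻¹ * (t * p))) :
    ℓ (q⁻¹ * (s * q)) < ℓ (p⁻¹ * (t * p)) := by
  have hδ := h.pos
  have hqt : gp ℓ q (t * p) p = r := by rw [gp, hq, hq']; ring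
  have hsq : ℓ ((s * p)⁻¹ * (s * q)) = r := by
    rw [← hq]; congr 1; group
  have hpsq : ℓ (p⁻¹ * (s * q)) = ℓ (q⁻¹ * (s⁻¹ * p)) := by
    rw [← h.inv]; congr 1; group
  rcases lt_or_ge (ℓ (p⁻¹ * (s * p)) / 2 - 6 * δ) r with hlt | hge
  · have t1 := h.dist_triangle q p (s * q)
    have t2 := h.dist_triangle p (s * p) (s * q)
    rw [h.dist_comm q p] at t1
    linarith
  have hs_t : r ≤ gp ℓ (s * p) (t * p) p := by
    rcases h.le_gp_of_not_isLoxodromic hs ht hst p with K | K <;> linarith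
  have h1 : r - δ ≤ gp ℓ q (s * p) p := by
    rw [h.gp_comm (s * p)] at hs_t
    rcases h.gp_four_point q (t * p) (s * p) p with K | K <;> linarith
  have h2 : r - 2 * δ ≤ gp ℓ q (s⁻¹ * p) p := by
    have := h.le_gp_inv hs p
    rw [h.gp_comm] at this
    rcases h.gp_four_point q (s * p) (s⁻¹ * p) p with K | K <;> linarith
  rw [gp, hq] at h1 h2
  rw [h.length_inv_smul] at h2
  have c1 := h.dist_comm (s * p) (s * q)
  rcases h.four_point q p (s * q) (s * p) with K | K
  · rw [h.dist_comm q p] at K; linarith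
  · rw [h.dist_comm p (s * q), h.dist_comm (s * q) p] at K
    linarith

/-- Finite sets of elements none of whose quotients are loxodromic have a common point of
bounded displacement. -/
theorem exists_displacement_le {len : G → ℕ} (h : IsHypLength (fun g => (len g : ℝ)) δ)
    (geod : ∀ g t, t ≤ len g → ∃ q, len q = t ∧ len (q⁻¹ * g) + t = len g)
    {Γ : Subgroup G} (hΓ : ∀ g ∈ Γ, ¬ IsLoxodromic (fun g => (len g : ℝ)) g)
    (F : Finset G) (hF : ∀ g ∈ F, g ∈ Γ) :
    ∃ p, ∀ s ∈ F, (len (p⁻¹ * (s * p)) : ℝ) ≤ 4 * ⌈5 * δ⌉₊ + 12 * δ := by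
  have hδ := h.pos
  let f : G → ℕ := fun p => F.sup fun s => len (p⁻¹ * (s * p))
  let p := Function.argmin f
  refine ⟨p, fun s hs => ?_⟩
  by_contra! hbig
  obtain ⟨t, htF, ht⟩ := F.exists_mem_eq_sup ⟨s, hs⟩ fun s => len (p⁻¹ * (s * p))
  have hmax : ∀ u ∈ F, len (p⁻¹ * (u * p)) ≤ len (p⁻¹ * (t * p)) := fun u hu => by
    rw [← ht]; exact Finset.le_sup (f := fun s => len (p⁻¹ * (s * p))) hu
  have hbig' : (4 * ⌈5 * δ⌉₊ + 12 * δ : ℝ) < len (p⁻¹ * (t * p)) :=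
    hbig.trans_le (by exact_mod_cast hmax s hs)
  have hle : ⌈5 * δ⌉₊ ≤ len (p⁻¹ * (t * p)) := by
    have : (⌈5 * δ⌉₊ : ℝ) ≤ len (p⁻¹ * (t * p)) := by
      have : (0 : ℝ) ≤ (⌈5 * δ⌉₊ : ℝ) := by positivity
      linarith
    exact_mod_cast this
  obtain ⟨q, hq, hq'⟩ := geod _ _ hle
  refine Function.not_lt_argmin f (p * q) ?_
  change (F.sup fun s => len ((p * q)⁻¹ * (s * (p * q)))) < f p
  have hfp : f p = len (p⁻¹ * (t * p)) := ht
  rw [hfp, Finset.sup_lt_iff]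
  · intro u hu
    have hut : u⁻¹ * t ∈ Γ := Γ.mul_mem (Γ.inv_mem (hF u hu)) (hF t htF)
    have := h.displacement_lt (hΓ u (hF u hu)) (hΓ t (hF t htF)) (hΓ _ hut) (p := p)
      (q := p * q) (r := ⌈5 * δ⌉₊) (by exact_mod_cast hmax u hu) (by simp [hq]) (by
        rw [show (p * q)⁻¹ * (t * p) = q⁻¹ * (p⁻¹ * (t * p)) by group, eq_sub_iff_add_eq]
        exact_mod_cast hq') (Nat.le_ceil _) hbig'
    exact_mod_cast this
  · have : (0 : ℝ) < len (p⁻¹ * (t * p)) := lt_of_le_of_lt (by positivity) hbig'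
    exact_mod_cast this

/-- Infinite subgroups contain loxodromic elements. -/
theorem exists_isLoxodromic {len : G → ℕ} (h : IsHypLength (fun g => (len g : ℝ)) δ)
    (geod : ∀ g t, t ≤ len g → ∃ q, len q = t ∧ len (q⁻¹ * g) + t = len g)
    (Γ : Subgroup G) [Infinite Γ] : ∃ g ∈ Γ, IsLoxodromic (fun g => (len g : ℝ)) g := by
  by_contra! hΓ
  have hball := h.finite_ball (4 * ⌈5 * δ⌉₊ + 12 * δ)
  obtain ⟨F, hF, hcard⟩ := Set.Infinite.exists_subset_card_eq
    (Set.infinite_coe_iff.1 ‹Infinite Γ› : (Γ : Set G).Infinite) (hball.toFinset.card + 1)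
  obtain ⟨p, hp⟩ := h.exists_displacement_le geod hΓ F hF
  have := Finset.card_le_card_of_injOn (s := F) (t := hball.toFinset)
    (fun s => p⁻¹ * (s * p)) (fun s hs => by simpa using hp s hs)
    (fun a _ b _ hab => by simpa using hab)
  omega

end Existence

section Axis

variable {G : Type*} [Group G] {ℓ : G → ℝ} {δ : ℝ}

/-- A point with small Gromov product relative to two points of a quasi-geodesic is close to it. -/
theorem exists_pow_near (h : IsHypLength ℓ δ) {b : G} {C K : ℝ}
    (hb : ∀ i j : ℕ, ℓ (b ^ i) + ℓ (b ^ j) ≤ ℓ (b ^ (i + j)) + C) {y : G} {l : ℕ}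
    (hy : gp ℓ 1 (b ^ l) y ≤ K) : ∃ i, ℓ (y⁻¹ * b ^ i) ≤ C / 2 + 2 * (K + δ + ℓ b) := by
  classical
  have hδ := h.pos
  have hℓb := h.nonneg b
  have hC : 0 ≤ C := by simpa [h.one] using hb 0 0
  have hK : 0 ≤ K := (h.gp_nonneg _ _ _).trans hy
  have hex : ∃ i, gp ℓ 1 (b ^ i) y ≤ K + δ := ⟨l, by linarith⟩
  have hfind := Nat.find_spec hex
  have hle : Nat.find hex ≤ l := Nat.find_min' hex (by linarith)
  rcases hi : Nat.find hex with _ | m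
  · rw [hi] at hfind
    refine ⟨0, ?_⟩
    simp only [gp, pow_zero, inv_one, mul_one, h.one] at hfind ⊢
    linarith
  · have hm : K + δ < gp ℓ 1 (b ^ m) y := not_le.1 (Nat.find_min hex (by omega))
    rw [hi] at hfind hle
    refine ⟨m + 1, ?_⟩
    have h1 : gp ℓ (b ^ m) (b ^ l) y ≤ K + δ := by
      rcases h.gp_four_point 1 (b ^ m) (b ^ l) y with H | H <;> linarith
    have h2 := h.gp_left_le (b ^ (m + 1)) (b ^ m) (b ^ l) y
    have e1 : ℓ ((b ^ (m + 1))⁻¹ * b ^ m) = ℓ b := by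
      rw [h.dist_comm, inv_pow_mul_pow b (Nat.le_succ m)]; simp
    have e2 := inv_pow_mul_pow b hle
    have h3 := hb (m + 1) (l - (m + 1))
    rw [show m + 1 + (l - (m + 1)) = l by omega] at h3
    have h4 := h.dist_triangle 1 y (b ^ l)
    rw [h.dist_comm 1 y] at h4
    rw [e1] at h2
    simp only [gp, e2, inv_one, one_mul] at hfind h1 h2 h4
    linarith

/-- If the quasi-geodesics `h * a ^ k` and `b ^ l` fellow-travel indefinitely, then the points of
the first are eventually uniformly close to the second. -/
theorem eventually_exists_pow_near (h : IsHypLength ℓ δ) {a b : G} {C : ℝ}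
    (ha : ∀ i j : ℕ, ℓ (a ^ i) + ℓ (a ^ j) ≤ ℓ (a ^ (i + j)) + C)
    (hb : ∀ i j : ℕ, ℓ (b ^ i) + ℓ (b ^ j) ≤ ℓ (b ^ (i + j)) + C)
    (ha' : ∀ R, ∃ N : ℕ, ∀ n, N ≤ n → R < ℓ (a ^ n)) {g : G}
    (hg : ∀ M : ℝ, ∃ k l : ℕ, M ≤ gp ℓ (g * a ^ k) (b ^ l) 1) :
    ∃ J : ℕ, ∀ j, J ≤ j →
      ∃ i, ℓ ((g * a ^ j)⁻¹ * b ^ i) ≤ C / 2 + 2 * (C / 2 + 2 * δ + δ + ℓ b) := by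
  have hδ := h.pos
  obtain ⟨J, hJ⟩ := ha' (2 * ℓ g + C / 2 + 2 * δ)
  refine ⟨J, fun j hj => ?_⟩
  have hjl := hJ j hj
  obtain ⟨k, l, hkl⟩ := hg (2 * ℓ g + 2 * j * ℓ a + C / 2 + 2 * δ + 1)
  have hC : 0 ≤ C := by simpa [h.one] using ha 0 0
  have hlj := h.pow_length_le a j
  have hlj0 := h.nonneg (a ^ j)
  have hg0 := h.nonneg g
  have ha0 := h.nonneg a
  have hja : 0 ≤ (j : ℝ) * ℓ a := by positivity
  set y := g * a ^ j with hy
  have hly : ℓ y ≤ ℓ g + j * ℓ a := (h.mul_le _ _).trans (by linarith)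
  have hjk : j ≤ k := by
    by_contra! hlt
    have h1 := h.gp_le_left (g * a ^ k) (b ^ l) 1
    have h2 := h.mul_le g (a ^ k)
    have h3 := h.pow_length_le a k
    have h4 : (k : ℝ) * ℓ a ≤ j * ℓ a := by gcongr
    simp only [inv_one, one_mul] at h1
    linarith
  refine h.exists_pow_near hb (l := l) ?_
  have yg : ℓ (y⁻¹ * g) = ℓ (a ^ j) := by
    rw [hy, h.dist_comm]; congr 1; group
  have p1 : gp ℓ g (g * a ^ k) y ≤ C / 2 := by
    have := ha j (k - j)
    rw [show j + (k - j) = k by omega] at this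
    have e1 : y⁻¹ * (g * a ^ k) = a ^ (k - j) := by
      rw [← inv_pow_mul_pow a hjk, hy]; group
    rw [gp, yg, e1, inv_mul_cancel_left]
    linarith
  have p2 : ℓ (a ^ j) - ℓ g ≤ gp ℓ g 1 y := by
    have := h.dist_triangle y 1 g
    rw [gp, yg]
    rw [yg] at this
    have e := h.inv g
    simp only [inv_one, one_mul, mul_one] at this ⊢
    linarith
  have p3 := h.gp_base_le (g * a ^ k) (b ^ l) 1 y
  simp only [inv_one, one_mul] at p3
  rw [h.gp_comm] at p3
  rcases h.gp_four_point g 1 (g * a ^ k) y with H | H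
  · linarith
  rcases h.gp_four_point 1 (b ^ l) (g * a ^ k) y with H' | H'
  · linarith
  · rw [h.gp_comm (b ^ l) (g * a ^ k) 1] at p3
    rw [h.gp_comm (b ^ l) (g * a ^ k) y] at H'
    linarith

/-- If `h * a ^ k` and `b ^ l` fellow-travel indefinitely, then some element of a fixed ball
commensurates `a` to `b`. -/
theorem exists_short_commensurator (h : IsHypLength ℓ δ) {a b : G} {C : ℝ}
    (ha : ∀ i j : ℕ, ℓ (a ^ i) + ℓ (a ^ j) ≤ ℓ (a ^ (i + j)) + C)
    (hb : ∀ i j : ℕ, ℓ (b ^ i) + ℓ (b ^ j) ≤ ℓ (b ^ (i + j)) + C)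
    (ha' : ∀ R, ∃ N : ℕ, ∀ n, N ≤ n → R < ℓ (a ^ n)) {g : G}
    (hg : ∀ M : ℝ, ∃ k l : ℕ, M ≤ gp ℓ (g * a ^ k) (b ^ l) 1) :
    ∃ f, ℓ f ≤ C / 2 + 2 * (C / 2 + 2 * δ + δ + ℓ b) ∧ ∃ i j i' j' : ℕ, j ≠ j' ∧
      b ^ i * f = g * a ^ j ∧ b ^ i' * f = g * a ^ j' := by
  obtain ⟨J, hJ⟩ := h.eventually_exists_pow_near ha hb ha' hg
  choose! i hi using hJ
  obtain ⟨j, hj, j', -, hne, heq⟩ := (Set.Ici_infinite J).exists_ne_map_eq_of_mapsTo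
    (f := fun j => (b ^ i j)⁻¹ * (g * a ^ j))
    (t := {f | ℓ f ≤ C / 2 + 2 * (C / 2 + 2 * δ + δ + ℓ b)})
    (fun j hj => by
      change ℓ _ ≤ _
      rw [h.dist_comm]
      exact hi j hj) (h.finite_ball _)
  refine ⟨(b ^ i j)⁻¹ * (g * a ^ j), ?_, i j, j, i j', j', hne, by group, ?_⟩
  · rw [h.dist_comm]; exact hi j hj
  · rw [heq]; group

/-- The translates `g` of the axis of `a` whose overlap with the axis is unbounded lie in finitely
many right cosets of the subgroup generated by `a`. -/
theorem exists_finite_cosets (h : IsHypLength ℓ δ) {a : G} (ha : IsLoxodromic ℓ a) :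
    ∃ T : Set G, T.Finite ∧ ∀ g, (¬ ∃ R, ∀ k l : ℤ, gp ℓ (g * a ^ k) (a ^ l) 1 ≤ R) →
      ∃ f ∈ T, ∃ m : ℤ, g = a ^ m * f := by
  classical
  obtain ⟨⟨C, hC⟩, hunb⟩ := ha
  set D := C / 2 + 2 * (C / 2 + 2 * δ + δ + ℓ a) with hD
  let F : Set G := {f | ℓ f ≤ D ∧ ∃ p : ℤ, 0 < p ∧ ∃ q : ℤ, SemiconjBy f (a ^ p) (a ^ q)}
  have hF : F.Finite := (h.finite_ball D).subset fun f hf => hf.1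
  have hper : ∀ f ∈ F, ∃ p : ℤ, 0 < p ∧ ∃ q : ℤ, SemiconjBy f (a ^ p) (a ^ q) := fun f hf => hf.2
  choose! p hp q hq using hper
  refine ⟨⋃ f ∈ F, (fun r : ℤ => f * a ^ r) '' Set.Ico 0 (p f),
    hF.biUnion fun f _ => (Set.finite_Ico _ _).image _, fun g hg => ?_⟩
  obtain ⟨f, hfF, m, n, rfl⟩ : ∃ f ∈ F, ∃ m n : ℤ, g = a ^ m * f * a ^ n := by
    have hsign : ∃ ε ∈ ({1, -1} : Set ℤ), ∃ η ∈ ({1, -1} : Set ℤ),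
        ∀ M : ℝ, ∃ k l : ℕ, M ≤ gp ℓ (g * (a ^ ε) ^ k) ((a ^ η) ^ l) 1 := by
      by_contra! H
      obtain ⟨M₁, h₁⟩ := H 1 (by simp) 1 (by simp)
      obtain ⟨M₂, h₂⟩ := H 1 (by simp) (-1) (by simp)
      obtain ⟨M₃, h₃⟩ := H (-1) (by simp) 1 (by simp)
      obtain ⟨M₄, h₄⟩ := H (-1) (by simp) (-1) (by simp)
      refine hg ⟨max (max M₁ M₂) (max M₃ M₄), fun k l => ?_⟩
      simp only [le_max_iff]
      obtain ⟨k, rfl | rfl⟩ := k.eq_nat_or_neg <;> obtain ⟨l, rfl | rfl⟩ := l.eq_nat_or_neg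
      · exact .inl (.inl (by simpa using (h₁ k l).le))
      · exact .inl (.inr (by simpa using (h₂ k l).le))
      · exact .inr (.inl (by simpa using (h₃ k l).le))
      · exact .inr (.inr (by simpa using (h₄ k l).le))
    obtain ⟨ε, hε, η, hη, H⟩ := hsign
    have hlen : ∀ ε ∈ ({1, -1} : Set ℤ), ∀ n : ℕ, ℓ ((a ^ ε) ^ n) = ℓ (a ^ n) := by
      rintro ε (rfl | rfl) n
      · simp
      · rw [zpow_neg, zpow_one, inv_pow, h.inv]
    have hlen1 : ℓ (a ^ η) = ℓ a := by simpa using hlen η hη 1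
    obtain ⟨f, hf, i, j, i', j', hne, e, e'⟩ := h.exists_short_commensurator
      (a := a ^ ε) (b := a ^ η) (C := C) (by simpa only [hlen ε hε] using hC)
      (by simpa only [hlen η hη] using hC) (by simpa only [hlen ε hε] using hunb) H
    rw [hlen1] at hf
    have hε0 : ε ≠ 0 := by rcases hε with rfl | rfl <;> decide
    simp only [← zpow_natCast, ← zpow_mul] at e e'
    have key : SemiconjBy f (a ^ (ε * (j' - j))) (a ^ (η * (i' - i))) := by
      have hg' : g = a ^ (η * i) * f * a ^ (-(ε * j)) := by
        rw [e, mul_assoc, ← zpow_add]; simp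
      rw [hg', mul_assoc, ← zpow_add] at e'
      rw [SemiconjBy, show ε * ((j' : ℤ) - j) = -(ε * j) + ε * j' by ring,
        show η * ((i' : ℤ) - i) = -(η * i) + η * i' by ring, zpow_add a (-(η * i)), mul_assoc, e',
        zpow_neg]
      group
    refine ⟨f, ⟨hf, ?_⟩, η * i, -(ε * j), by rw [e, mul_assoc, ← zpow_add]; simp⟩
    have hne' : ε * ((j' : ℤ) - j) ≠ 0 := mul_ne_zero hε0 (by omega)
    rcases hne'.lt_or_gt with hlt | hgt
    · refine ⟨-(ε * (j' - j)), by omega, -(η * (i' - i)), ?_⟩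
      rw [zpow_neg, zpow_neg]
      exact key.inv_right
    · exact ⟨_, hgt, _, key⟩
  refine ⟨f * a ^ (n % p f), ?_, m + q f * (n / p f), ?_⟩
  · exact Set.mem_biUnion hfF ⟨_, ⟨Int.emod_nonneg _ (hp f hfF).ne',
      Int.emod_lt_of_pos _ (hp f hfF)⟩, rfl⟩
  · have hs : f * (a ^ p f) ^ (n / p f) = (a ^ q f) ^ (n / p f) * f :=
      (hq f hfF).zpow_right (n / p f)
    rw [← zpow_mul, ← zpow_mul] at hs
    calc a ^ m * f * a ^ n = a ^ m * (f * a ^ (p f * (n / p f))) * a ^ (n % p f) := by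
          rw [mul_assoc, mul_assoc, mul_assoc, ← zpow_add, Int.mul_ediv_add_emod]
      _ = a ^ (m + q f * (n / p f)) * (f * a ^ (n % p f)) := by
          rw [hs, zpow_add]; simp only [mul_assoc]

open scoped Pointwise in
/-- In a group that is not virtually cyclic, some translate of the axis of `a` has bounded overlap
with finitely many prescribed translates of the axis. -/
theorem exists_translate (h : IsHypLength ℓ δ) (hne : ¬ IsVirtuallyCyclic G) {a : G}
    (ha : IsLoxodromic ℓ a) (X : Finset G) :
    ∃ g, ∀ x ∈ X, ∃ R, ∀ k l : ℤ, gp ℓ (x * g * a ^ k) (a ^ l) 1 ≤ R := by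
  by_contra! H
  obtain ⟨T, hT, hcover⟩ := h.exists_finite_cosets ha
  have hcov : ⋃ i ∈ X ×ˢ hT.toFinset,
      (i.1⁻¹ * i.2) • (Subgroup.zpowers (i.2⁻¹ * a * i.2) : Set G) = Set.univ := by
    refine Set.eq_univ_of_forall fun g => ?_
    obtain ⟨x, hx, hg⟩ := H g
    obtain ⟨f, hf, m, hm⟩ := hcover (x * g) (by push Not; exact hg)
    refine Set.mem_biUnion (x := (x, f)) (by simpa using ⟨hx, hf⟩) ?_
    refine ⟨(f⁻¹ * a * f) ^ m, ⟨m, rfl⟩, ?_⟩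
    have := conj_zpow (a := f⁻¹) (b := a) (i := m)
    rw [inv_inv] at this
    simp only [smul_eq_mul]
    rw [this, ← mul_right_inj x, hm]
    group
  obtain ⟨i, -, hi⟩ := Subgroup.exists_finiteIndex_of_leftCoset_cover hcov
  exact hne ⟨_, hi.index_ne_zero⟩

end Axis

end IsHypLength

/-- Elements `a`, `b` all of whose nonzero powers play ping-pong on the sets `U`, `V`, in such a
way that the elements of `X` map `V` off `U`. -/
structure IsPingPong {G : Type*} [Group G] (a b : G) (U V X : Set G) : Prop where
  one_notMem_left : 1 ∉ U
  one_notMem_right : 1 ∉ V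
  disjoint : Disjoint U V
  left : ∀ n : ℤ, n ≠ 0 → ∀ y ∉ U, a ^ n * y ∈ U
  right : ∀ n : ℤ, n ≠ 0 → ∀ y ∉ V, b ^ n * y ∈ V
  move : ∀ x ∈ X, ∀ y ∈ V, x * y ∉ U

namespace IsHypLength

section PingPong

variable {G : Type*} [Group G] {ℓ : G → ℝ} {δ : ℝ}

/-- The points that follow the translate by `g` of the axis of `a` for a time more than `R`. -/
def axisNhd (ℓ : G → ℝ) (a g : G) (R : ℝ) : Set G :=
  {y | ∃ k : ℤ, R < gp ℓ y (g * a ^ k) 1}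

theorem one_notMem_axisNhd (h : IsHypLength ℓ δ) (a g : G) {R : ℝ} (hR : 0 ≤ R) :
    1 ∉ axisNhd ℓ a g R := by
  rintro ⟨k, hk⟩
  have := h.gp_le_left 1 (g * a ^ k) 1
  simp only [inv_one, one_mul, h.one] at this
  linarith

theorem mul_mem_axisNhd (h : IsHypLength ℓ δ) {a g : G} {R : ℝ} {n : ℤ}
    (hn : 2 * R + 2 * ℓ g < ℓ (a ^ n)) {y : G} (hy : y ∉ axisNhd ℓ a g R) :
    g * a ^ n * g⁻¹ * y ∈ axisNhd ℓ a g R := by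
  refine ⟨n, ?_⟩
  have hy' : gp ℓ y (g * a ^ (-n)) 1 ≤ R := not_lt.1 fun H => hy ⟨_, H⟩
  have h1 := h.gp_base_le y (g * a ^ (-n)) g 1
  have h2 := h.gp_base_le y g (g * a ^ (-n)) (g * a ^ (-n) * g⁻¹)
  have h3 : gp ℓ (g * a ^ n * g⁻¹ * y) (g * a ^ n) 1 = gp ℓ y g (g * a ^ (-n) * g⁻¹) := by
    rw [← gp_mul_left (g * a ^ n * g⁻¹) y g]
    congr 1 <;> group
  have e1 : ℓ ((g * a ^ (-n))⁻¹ * (g * a ^ (-n) * g⁻¹)) = ℓ g := by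
    rw [← h.inv g]; congr 1; group
  have e2 : ℓ (g⁻¹ * (g * a ^ (-n))) = ℓ (a ^ n) := by
    rw [← h.inv (a ^ n)]; congr 1; group
  have e3 := h.dist_comm y g
  have e4 := h.dist_comm y (g * a ^ (-n))
  have e5 := h.dist_comm g (g * a ^ (-n))
  rw [mul_one, h.inv] at h1
  rw [e1] at h2
  have h4 : gp ℓ y g (g * a ^ (-n)) + gp ℓ y (g * a ^ (-n)) g = ℓ (a ^ n) := by
    simp only [gp]; linarith
  linarith

theorem mul_notMem_axisNhd (h : IsHypLength ℓ δ) {a g x : G} {R R' : ℝ}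
    (hx : ∀ k l : ℤ, gp ℓ (x * g * a ^ k) (a ^ l) 1 ≤ R') (hR : R' + ℓ x + δ ≤ R)
    {y : G} (hy : y ∈ axisNhd ℓ a g R) : x * y ∉ axisNhd ℓ a 1 R := by
  rintro ⟨l, hl⟩
  obtain ⟨k, hk⟩ := hy
  have hδ := h.pos
  have hx0 := h.nonneg x
  have h1 := h.gp_base_le (x * y) (x * (g * a ^ k)) (x * 1) 1
  rw [gp_mul_left, mul_one, mul_one, h.inv, ← mul_assoc, h.gp_comm (x * y)] at h1
  rw [one_mul] at hl
  rcases h.gp_four_point (x * g * a ^ k) (x * y) (a ^ l) 1 with H | H <;> linarith [hx k l]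

theorem exists_isPingPong (h : IsHypLength ℓ δ) (hne : ¬ IsVirtuallyCyclic G) {a : G}
    (ha : IsLoxodromic ℓ a) (X : Finset G) :
    ∃ b c : G, ∃ U V : Set G, IsPingPong b c U V X := by
  classical
  obtain ⟨g, hg⟩ := h.exists_translate hne ha (insert 1 X)
  choose! R hR using hg
  obtain ⟨K, hK⟩ := ((insert 1 X).image fun x => R x + ℓ x + δ).exists_le
  have hK' : ∀ x ∈ insert 1 X, R x + ℓ x + δ ≤ max K 0 := fun x hx =>
    (hK _ (Finset.mem_image_of_mem _ hx)).trans (le_max_left _ _)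
  set S := max K 0
  have hS : 0 ≤ S := le_max_right _ _
  have hg0 := h.nonneg g
  obtain ⟨N, hN⟩ := ha.unbounded (2 * S + 2 * ℓ g)
  have hpow : ∀ n : ℤ, n ≠ 0 → 2 * S + 2 * ℓ g < ℓ (a ^ (((N : ℤ) + 1) * n)) := fun n hn => by
    obtain ⟨m, rfl | rfl⟩ := n.eq_nat_or_neg
    · have hm : 1 ≤ m := by omega
      have := hN ((N + 1) * m) (by nlinarith)
      rwa [← zpow_natCast, Nat.cast_mul, Nat.cast_succ] at this
    · have hm : 1 ≤ m := by omega
      have := hN ((N + 1) * m) (by nlinarith)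
      rw [← zpow_natCast, Nat.cast_mul, Nat.cast_succ] at this
      rwa [mul_neg, zpow_neg, h.inv]
  refine ⟨a ^ ((N : ℤ) + 1), g * a ^ ((N : ℤ) + 1) * g⁻¹, axisNhd ℓ a 1 S, axisNhd ℓ a g S,
    h.one_notMem_axisNhd a 1 hS, h.one_notMem_axisNhd a g hS, ?_, ?_, ?_, ?_⟩
  · rw [Set.disjoint_right]
    intro y hy
    have := h.mul_notMem_axisNhd (hR 1 (by simp)) (hK' 1 (by simp)) hy
    rwa [one_mul] at this
  · intro n hn y hy
    have := h.mul_mem_axisNhd (g := 1) (by rw [h.one]; linarith [hpow n hn]) hy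
    rwa [one_mul, inv_one, mul_one, zpow_mul] at this
  · intro n hn y hy
    rw [conj_zpow, ← zpow_mul]
    exact h.mul_mem_axisNhd (hpow n hn) hy
  · intro x hx y hy
    exact h.mul_notMem_axisNhd (hR x (Finset.mem_insert_of_mem hx))
      (hK' x (Finset.mem_insert_of_mem hx)) hy

end PingPong

end IsHypLength

namespace IsPingPong

section Words

variable {G : Type*} [Group G] {a b : G} {U V X : Set G} {m : ℕ}

/-- The generators `a`, `b` and `a ^ e * x i * b ^ e` with `e = N * (i + 1)`. -/
def longGens (N : ℤ) (a b : G) (x : Fin m → G) : Bool ⊕ Fin m → G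
  | .inl true => a
  | .inl false => b
  | .inr i => a ^ (N * (i + 1)) * x i * b ^ (N * (i + 1))

theorem closure_longGens (N : ℤ) (a b : G) {x : Fin m → G}
    (hx : Subgroup.closure (Set.range x) = ⊤) :
    Subgroup.closure (Set.range (longGens N a b x)) = ⊤ := by
  rw [eq_top_iff, ← hx, Subgroup.closure_le]
  rintro _ ⟨i, rfl⟩
  have hmem : ∀ t, longGens N a b x t ∈ Subgroup.closure (Set.range (longGens N a b x)) :=
    fun t => Subgroup.subset_closure ⟨t, rfl⟩
  have ha := Subgroup.zpow_mem _ (hmem (.inl true)) (N * (i + 1))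
  have hb := Subgroup.zpow_mem _ (hmem (.inl false)) (N * (i + 1))
  have := Subgroup.mul_mem _ (Subgroup.mul_mem _ (Subgroup.inv_mem _ ha) (hmem (.inr i)))
    (Subgroup.inv_mem _ hb)
  rw [SetLike.mem_coe]
  convert this using 1
  simp only [longGens]
  group

/-- `y` is obtained by applying `c ^ n` to a point outside `W`. -/
def IsPowTranslate (c : G) (W : Set G) (n : ℤ) (y : G) : Prop :=
  ∃ z ∉ W, y = c ^ n * z

theorem IsPowTranslate.zpow_mul {c : G} {W : Set G} {n : ℤ} {y : G}
    (h : IsPowTranslate c W n y) (k : ℤ) : IsPowTranslate c W (k + n) (c ^ k * y) := by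
  obtain ⟨z, hz, rfl⟩ := h
  exact ⟨z, hz, by rw [zpow_add, mul_assoc]⟩

theorem IsPowTranslate.of_notMem {c : G} {W : Set G} {y : G} (hy : y ∉ W) :
    IsPowTranslate c W 0 y :=
  ⟨y, hy, by simp⟩

theorem mem_left (h : IsPingPong a b U V X) {n : ℤ} {y : G} (hy : IsPowTranslate a U n y)
    (hn : n ≠ 0) : y ∈ U := by
  obtain ⟨z, hz, rfl⟩ := hy
  exact h.left n hn z hz

theorem mem_right (h : IsPingPong a b U V X) {n : ℤ} {y : G} (hy : IsPowTranslate b V n y)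
    (hn : n ≠ 0) : y ∈ V := by
  obtain ⟨z, hz, rfl⟩ := hy
  exact h.right n hn z hz

/-- The element represented by a word in the generators `s`. -/
def evalWord {α : Type*} (s : α → G) (L : List (α × Bool)) : G :=
  (L.map fun t => cond t.2 (s t.1) (s t.1)⁻¹).prod

theorem evalWord_cons {α : Type*} (s : α → G) (t : α) (e : Bool) (L : List (α × Bool)) :
    evalWord s ((t, e) :: L) = cond e (s t) (s t)⁻¹ * evalWord s L := by
  simp [evalWord]

/-- The exponent of a letter. -/
def sign (e : Bool) : ℤ := cond e 1 (-1)

theorem cond_inv_eq_zpow (g : G) (e : Bool) : cond e g g⁻¹ = g ^ sign e := by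
  cases e <;> simp [sign]

theorem sign_mul_add_ne_zero {N k : ℤ} (h1 : 1 ≤ k) (h2 : k < N) (e : Bool) (o : ℤ) :
    sign e * k + N * o ≠ 0 := by
  intro h
  have hdvd : N ∣ k := by
    cases e
    · exact ⟨o, by simp only [sign, cond_false] at h; linarith⟩
    · exact ⟨-o, by simp only [sign, cond_true] at h; linarith⟩
  have := Int.le_of_dvd (by omega) hdvd
  omega

/-- The position of the point `y` reached by a word of length `len` with first letter `t`. -/
def HeadPosition (N : ℤ) (a b : G) (U V : Set G) (len : ℕ) (y : G) :
    (Bool ⊕ Fin m) × Bool → Prop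
  | (.inl true, e) => ∃ k o : ℤ, 1 ≤ k ∧ k ≤ len ∧ IsPowTranslate a U (sign e * k + N * o) y
  | (.inl false, e) => ∃ k o : ℤ, 1 ≤ k ∧ k ≤ len ∧ IsPowTranslate b V (sign e * k + N * o) y
  | (.inr i, true) => IsPowTranslate a U (N * (i + 1)) y
  | (.inr i, false) => IsPowTranslate b V (-(N * (i + 1))) y

theorem HeadPosition.mem (h : IsPingPong a b U V X) {N : ℤ} {len : ℕ} (hlen : len < N) {y : G}
    {t : (Bool ⊕ Fin m) × Bool} (ht : HeadPosition N a b U V len y t) : y ∈ U ∨ y ∈ V := by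
  have hN : 0 < N := by omega
  rcases t with ⟨(_ | _) | i, e⟩
  · obtain ⟨k, o, h1, h2, h3⟩ := ht
    exact .inr (h.mem_right h3 (sign_mul_add_ne_zero h1 (by omega) e o))
  · obtain ⟨k, o, h1, h2, h3⟩ := ht
    exact .inl (h.mem_left h3 (sign_mul_add_ne_zero h1 (by omega) e o))
  · have : N * ((i : ℤ) + 1) ≠ 0 := by positivity
    cases e
    · exact .inr (h.mem_right ht (neg_ne_zero.2 this))
    · exact .inl (h.mem_left ht this)

/-- The condition under which prepending the letter `t` to a word of length `len` that leads to `y`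
gives a word in the corresponding head position. -/
def Prependable (N : ℤ) (a b : G) (U V : Set G) (len : ℕ) (y : G) : (Bool ⊕ Fin m) × Bool → Prop
  | (.inl true, e) => ∃ k o : ℤ, 0 ≤ k ∧ k ≤ len ∧ IsPowTranslate a U (sign e * k + N * o) y
  | (.inl false, e) => ∃ k o : ℤ, 0 ≤ k ∧ k ≤ len ∧ IsPowTranslate b V (sign e * k + N * o) y
  | (.inr i, true) => ∃ n, IsPowTranslate b V n y ∧ N * (i + 1) + n ≠ 0
  | (.inr i, false) => ∃ n, IsPowTranslate a U n y ∧ -(N * (i + 1)) + n ≠ 0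

theorem prependable_of_notMem_left {N : ℤ} {len : ℕ} (hN : 0 < N) {y : G} (hy : y ∉ U) :
    (∀ e, Prependable (m := m) N a b U V len y (.inl true, e)) ∧
      ∀ i : Fin m, Prependable N a b U V len y (.inr i, false) :=
  ⟨fun e => ⟨0, 0, le_rfl, by omega, by simpa using IsPowTranslate.of_notMem hy⟩,
    fun i => ⟨0, .of_notMem hy, by simpa using ⟨hN.ne', by omega⟩⟩⟩

theorem prependable_of_notMem_right {N : ℤ} {len : ℕ} (hN : 0 < N) {y : G} (hy : y ∉ V) :
    (∀ e, Prependable (m := m) N a b U V len y (.inl false, e)) ∧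
      ∀ i : Fin m, Prependable N a b U V len y (.inr i, true) :=
  ⟨fun e => ⟨0, 0, le_rfl, by omega, by simpa using IsPowTranslate.of_notMem hy⟩,
    fun i => ⟨0, .of_notMem hy, by simpa using ⟨hN.ne', by omega⟩⟩⟩

theorem prependable_one (h : IsPingPong a b U V X) {N : ℤ} {len : ℕ} (hN : 0 < N)
    (u : (Bool ⊕ Fin m) × Bool) : Prependable N a b U V len 1 u := by
  have hl := prependable_of_notMem_left (a := a) (b := b) (V := V) (m := m) (len := len) hN
    h.one_notMem_left
  have hr := prependable_of_notMem_right (a := a) (b := b) (U := U) (m := m) (len := len) hN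
    h.one_notMem_right
  rcases u with ⟨(_ | _) | i, _ | _⟩
  exacts [hr.1 _, hr.1 _, hl.1 _, hl.1 _, hl.2 _, hr.2 _]

theorem HeadPosition.prependable (h : IsPingPong a b U V X) {N : ℤ} {len : ℕ} (hlen : len < N)
    {y : G} {t u : (Bool ⊕ Fin m) × Bool} (ht : HeadPosition N a b U V len y t)
    (hu : u.1 = t.1 → u.2 = t.2) : Prependable N a b U V len y u := by
  have hN : 0 < N := by omega
  have hl : y ∉ U → _ :=
    prependable_of_notMem_left (a := a) (b := b) (V := V) (m := m) (len := len) hN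
  have hr : y ∉ V → _ :=
    prependable_of_notMem_right (a := a) (b := b) (U := U) (m := m) (len := len) hN
  have hpos : ∀ i : Fin m, N * ((i : ℤ) + 1) ≠ 0 := fun i => by positivity
  have hUV := Set.disjoint_left.1 h.disjoint
  have hVU := Set.disjoint_right.1 h.disjoint
  rcases t with ⟨(_ | _) | j, e⟩
  · obtain ⟨k, o, h1, h2, h3⟩ := ht
    replace hl := hl (hVU (h.mem_right h3 (sign_mul_add_ne_zero h1 (by omega) e o)))
    rcases u with ⟨(_ | _) | i, _ | _⟩
    · obtain rfl : false = e := hu rfl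
      exact ⟨k, o, by omega, h2, h3⟩
    · obtain rfl : true = e := hu rfl
      exact ⟨k, o, by omega, h2, h3⟩
    · exact hl.1 _
    · exact hl.1 _
    · exact hl.2 _
    · refine ⟨_, h3, ?_⟩
      rw [show N * ((i : ℤ) + 1) + (sign e * k + N * o) = sign e * k + N * (o + i + 1) by ring]
      exact sign_mul_add_ne_zero h1 (by omega) e _
  · obtain ⟨k, o, h1, h2, h3⟩ := ht
    replace hr := hr (hUV (h.mem_left h3 (sign_mul_add_ne_zero h1 (by omega) e o)))
    rcases u with ⟨(_ | _) | i, _ | _⟩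
    · exact hr.1 _
    · exact hr.1 _
    · obtain rfl : false = e := hu rfl
      exact ⟨k, o, by omega, h2, h3⟩
    · obtain rfl : true = e := hu rfl
      exact ⟨k, o, by omega, h2, h3⟩
    · refine ⟨_, h3, ?_⟩
      rw [show -(N * ((i : ℤ) + 1)) + (sign e * k + N * o) = sign e * k + N * (o - i - 1) by ring]
      exact sign_mul_add_ne_zero h1 (by omega) e _
    · exact hr.2 _
  · have hinj : ∀ i, i ≠ j → N * ((i : ℤ) + 1) ≠ N * ((j : ℤ) + 1) := fun i hij H => by
      have := mul_left_cancel₀ hN.ne' H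
      exact hij (Fin.ext (by omega))
    cases e
    · replace hl := hl (hVU (h.mem_right ht (neg_ne_zero.2 (hpos j))))
      rcases u with ⟨(_ | _) | i, e | _⟩
      · exact ⟨0, -(j + 1), le_rfl, by omega, by rwa [mul_zero, zero_add, mul_neg]⟩
      · exact ⟨0, -(j + 1), le_rfl, by omega, by rwa [mul_zero, zero_add, mul_neg]⟩
      · exact hl.1 _
      · exact hl.1 _
      · exact hl.2 _
      · have := hinj i (by rintro rfl; simp at hu)
        exact ⟨_, ht, by omega⟩
    · replace hr := hr (hUV (h.mem_left ht (hpos j)))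
      rcases u with ⟨(_ | _) | i, e | _⟩
      · exact hr.1 _
      · exact hr.1 _
      · exact ⟨0, j + 1, le_rfl, by omega, by rwa [mul_zero, zero_add]⟩
      · exact ⟨0, j + 1, le_rfl, by omega, by rwa [mul_zero, zero_add]⟩
      · have := hinj i (by rintro rfl; simp at hu)
        exact ⟨_, ht, by omega⟩
      · exact hr.2 _

theorem Prependable.headPosition (h : IsPingPong a b U V X) {x : Fin m → G} (hx : ∀ i, x i ∈ X)
    {N : ℤ} {len : ℕ} {y : G} {u : (Bool ⊕ Fin m) × Bool} (hu : Prependable N a b U V len y u) :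
    HeadPosition N a b U V (len + 1)
      (cond u.2 (longGens N a b x u.1) (longGens N a b x u.1)⁻¹ * y) u := by
  rcases u with ⟨(_ | _) | i, e⟩
  · obtain ⟨k, o, h1, h2, h3⟩ := hu
    refine ⟨k + 1, o, by omega, by omega, ?_⟩
    convert h3.zpow_mul (sign e) using 1
    · ring
    · exact congrArg (· * y) (cond_inv_eq_zpow b e)
  · obtain ⟨k, o, h1, h2, h3⟩ := hu
    refine ⟨k + 1, o, by omega, by omega, ?_⟩
    convert h3.zpow_mul (sign e) using 1
    · ring
    · exact congrArg (· * y) (cond_inv_eq_zpow a e)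
  · cases e
    · obtain ⟨n, h1, h2⟩ := hu
      have hU := h.mem_left (h1.zpow_mul (-(N * (i + 1)))) h2
      refine ⟨(x i)⁻¹ * (a ^ (-(N * ((i : ℤ) + 1))) * y), fun hV => ?_, ?_⟩
      · have := h.move _ (hx i) _ hV
        rw [mul_inv_cancel_left] at this
        exact this hU
      · simp only [cond_false, longGens]
        group
    · obtain ⟨n, h1, h2⟩ := hu
      exact ⟨x i * (b ^ (N * ((i : ℤ) + 1)) * y),
        h.move _ (hx i) _ (h.mem_right (h1.zpow_mul (N * (i + 1))) h2),
        by simp only [cond_true, longGens, mul_assoc]⟩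

theorem headPosition_evalWord (h : IsPingPong a b U V X) {x : Fin m → G} (hx : ∀ i, x i ∈ X)
    {N : ℤ} (t : (Bool ⊕ Fin m) × Bool) (L : List ((Bool ⊕ Fin m) × Bool))
    (hred : FreeGroup.IsReduced (t :: L)) (hlen : (t :: L).length < N) :
    HeadPosition N a b U V (t :: L).length (evalWord (longGens N a b x) (t :: L)) t := by
  rw [evalWord_cons]
  refine Prependable.headPosition h hx ?_
  induction L generalizing t with
  | nil => exact prependable_one h (by simp at hlen; omega) t
  | cons u L ih =>
    obtain ⟨htu, hred'⟩ := FreeGroup.isReduced_cons_cons.1 hred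
    simp only [List.length_cons] at hlen ih ⊢
    rw [evalWord_cons]
    exact (Prependable.headPosition h hx (ih u hred' (by omega))).prependable h
      (by push_cast at hlen ⊢; omega) htu

theorem lift_longGens_ne_one (h : IsPingPong a b U V X) {x : Fin m → G} (hx : ∀ i, x i ∈ X)
    {n : ℕ} {w : FreeGroup (Bool ⊕ Fin m)} (hw : w ≠ 1) (hn : w.norm ≤ n) :
    FreeGroup.lift (longGens ((n : ℤ) + 1) a b x) w ≠ 1 := by
  have hlift : FreeGroup.lift (longGens ((n : ℤ) + 1) a b x) w =
      evalWord (longGens ((n : ℤ) + 1) a b x) w.toWord := by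
    conv_lhs => rw [← FreeGroup.mk_toWord (x := w)]
    exact FreeGroup.lift_mk
  have hred : FreeGroup.IsReduced w.toWord := FreeGroup.isReduced_toWord
  rw [hlift]
  rw [FreeGroup.norm] at hn
  rcases hL : w.toWord with _ | ⟨t, L⟩
  · exact absurd (FreeGroup.toWord_eq_nil_iff.1 hL) hw
  rw [hL] at hn hred
  have hlen : ((t :: L).length : ℤ) < (n : ℤ) + 1 := by omega
  intro h1
  have := (headPosition_evalWord h hx t L hred hlen).mem h hlen
  rw [h1] at this
  exact this.elim h.one_notMem_left h.one_notMem_right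

end Words

end IsPingPong

/-- Infinite girth may be verified with generating families indexed by any finite type. -/
theorem hasInfiniteGirth_of_fintype {G : Type*} [Group G] {α : Type} [Fintype α] [DecidableEq α]
    (H : ∀ n : ℕ, ∃ s : α → G, Subgroup.closure (Set.range s) = ⊤ ∧
      ∀ w : FreeGroup α, w ≠ 1 → w.norm ≤ n → FreeGroup.lift s w ≠ 1) : HasInfiniteGirth G := by
  intro n
  obtain ⟨s, hs, hw⟩ := H n
  let e := (Fintype.equivFin α).symm
  refine ⟨Fintype.card α, s ∘ e, by rw [e.surjective.range_comp, hs], fun w hw1 hwn => ?_⟩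
  have hlift : FreeGroup.lift (s ∘ e) w = FreeGroup.lift s (FreeGroup.map e w) := by
    rw [FreeGroup.map_eq_lift]
    exact DFunLike.congr_fun (FreeGroup.ext_hom (f := FreeGroup.lift (s ∘ e))
      (g := (FreeGroup.lift s).comp (FreeGroup.lift (FreeGroup.of ∘ e))) (by simp)) w
  rw [hlift]
  refine hw _ (fun h => hw1 (FreeGroup.map_injective e.injective (by simpa using h))) ?_
  rw [← FreeGroup.mk_toWord (x := w), FreeGroup.map.mk]
  refine FreeGroup.norm_mk_le.trans ?_
  rwa [List.length_map]

theorem infinite_of_not_isVirtuallyCyclic {G : Type*} [Group G] (h : ¬ IsVirtuallyCyclic G) :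
    Infinite G := by
  by_contra hfin
  rw [not_infinite_iff_finite] at hfin
  exact h ⟨1, Subgroup.index_ne_zero_of_finite⟩

/-- Every finitely generated non-elementary subgroup of a word hyperbolic group has
infinite girth. -/
theorem girth_infinite_of_nonelementary_hyperbolic
    (G : Type*) [Group G] (hG : IsWordHyperbolic G)
    (Γ : Subgroup G) (hfg : Group.FG Γ) (hne : ¬ IsVirtuallyCyclic Γ) :
    HasInfiniteGirth Γ := by
  obtain ⟨S, hfin, hS, δ, hδ, hyp⟩ := hG
  have hℓ := isHypLength_wordLength hfin hS hδ hyp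
  have : Infinite Γ := infinite_of_not_isVirtuallyCyclic hne
  obtain ⟨g, hgΓ, hg⟩ := hℓ.exists_isLoxodromic
    (fun g t ht => exists_wordLength_eq hS g ht) Γ
  obtain ⟨T, hT⟩ := Group.fg_def.1 hfg
  obtain ⟨a, b, U, V, hpp⟩ := (hℓ.restrict Γ).exists_isPingPong hne (a := ⟨g, hgΓ⟩)
    ⟨hg.quasi_additive, hg.unbounded⟩ T
  let x : Fin T.card → Γ := fun i => T.equivFin.symm i
  have hx : Set.range x = T := by
    rw [show x = Subtype.val ∘ T.equivFin.symm from rfl,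
      T.equivFin.symm.surjective.range_comp]
    simp
  refine hasInfiniteGirth_of_fintype (α := Bool ⊕ Fin T.card) fun n =>
    ⟨IsPingPong.longGens ((n : ℤ) + 1) a b x,
      IsPingPong.closure_longGens _ a b (by rw [hx, hT]), fun w hw hwn =>
      IsPingPong.lift_longGens_ne_one hpp (fun i => hx ▸ Set.mem_range_self i) hw hwn⟩
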